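/- Let T = Σ_{j=1}^R w_j* β_{1,j}*∘β_{2,j}*∘β_{3,j}* + E ∈ ℝ^{d₁×d₂×d₃} with all w_j* > 0, all β_{i,j}* unit vectors, incoherence ξ := max over modes i and pairs j ≠ j′ of |⟨β_{i,j}*, β_{i,j′}*⟩|, w_max := max_j w_j*, and Σ_{j≠r} w_j* ≤ C₁ w_max. Fix r and let u, v be unit vectors with ‖u − β_{1,r}*‖₂ ≤ ε₀, ‖v − β_{2,r}*‖₂ ≤ ε₀, 0 < ε₀ < 1, and index sets F₁,F₂,F₃ with supp(u)∪supp(β_{1,r}*) ⊆ F₁, |F₁| ≤ s₁, supp(v)∪supp(β_{2,r}*) ⊆ F₂, |F₂| ≤ s₂, supp(β_{3,r}*) ⊆ F₃, |F₃| ≤ s₃. Then ‖T_F ×₁ u ×₂ v‖₂ ≥ w_r*(1 − ε₀²) − w_max [ 2ε₀ξ(R−1) + C₁ε₀² + ξ²(R−1) ] − η(E; s₁,s₂,s₃). -/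

import Mathlib

open scoped BigOperators
open Matrix

noncomputable def l2 {d : ℕ} (v : Fin d → ℝ) : ℝ := Real.sqrt (∑ i, v i ^ 2)

noncomputable def linf {d : ℕ} (v : Fin d → ℝ) : ℝ := ⨆ i, |v i|

noncomputable def tv {d : ℕ} (β : Fin d → ℝ) : ℝ :=
  ∑ j ∈ Finset.range (d - 1),
    if h : j + 1 < d then |β ⟨j + 1, h⟩ - β ⟨j, Nat.lt_of_succ_lt h⟩| else 0

noncomputable def contract3 {d₁ d₂ d₃ : ℕ} (T : Fin d₁ × Fin d₂ × Fin d₃ → ℝ)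
    (u : Fin d₁ → ℝ) (v : Fin d₂ → ℝ) : Fin d₃ → ℝ :=
  fun k => ∑ i, ∑ j, T (i, j, k) * u i * v j

def outer3 {d₁ d₂ d₃ : ℕ} (a : Fin d₁ → ℝ) (b : Fin d₂ → ℝ) (c : Fin d₃ → ℝ) :
    Fin d₁ × Fin d₂ × Fin d₃ → ℝ :=
  fun p => a p.1 * b p.2.1 * c p.2.2

noncomputable def eta {d₁ d₂ d₃ : ℕ} (E : Fin d₁ × Fin d₂ × Fin d₃ → ℝ)
    (s₁ s₂ s₃ : ℕ) : ℝ :=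
  sSup { x : ℝ | ∃ (u : Fin d₁ → ℝ) (v : Fin d₂ → ℝ) (w : Fin d₃ → ℝ),
    l2 u = 1 ∧ l2 v = 1 ∧ l2 w = 1 ∧
    (Function.support u).ncard ≤ s₁ ∧ (Function.support v).ncard ≤ s₂ ∧
    (Function.support w).ncard ≤ s₃ ∧
    x = |∑ i, ∑ j, ∑ k, E (i, j, k) * u i * v j * w k| }

noncomputable def restrict3 {d₁ d₂ d₃ : ℕ} (T : Fin d₁ × Fin d₂ × Fin d₃ → ℝ)
    (F₁ : Finset (Fin d₁)) (F₂ : Finset (Fin d₂)) (F₃ : Finset (Fin d₃)) :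
    Fin d₁ × Fin d₂ × Fin d₃ → ℝ :=
  fun p => if p.1 ∈ F₁ ∧ p.2.1 ∈ F₂ ∧ p.2.2 ∈ F₃ then T p else 0

noncomputable def restrictVec {d : ℕ} (v : Fin d → ℝ) (F : Finset (Fin d)) : Fin d → ℝ :=
  fun i => if i ∈ F then v i else 0

noncomputable def vnormalize {d : ℕ} (v : Fin d → ℝ) : Fin d → ℝ :=
  fun i => v i / l2 v

def Dmat (d : ℕ) : Matrix (Fin (d - 1)) (Fin d) ℝ :=
  fun j i => if (i : ℕ) = (j : ℕ) then -1 else if (i : ℕ) = (j : ℕ) + 1 then 1 else 0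

noncomputable def Dpinv (d : ℕ) : Matrix (Fin d) (Fin (d - 1)) ℝ :=
  (Dmat d)ᵀ * (Dmat d * (Dmat d)ᵀ)⁻¹

noncomputable def Mconst (d : ℕ) : ℝ :=
  ⨆ j : Fin (d - 1), l2 (fun i => Dpinv d i j)

def gfun (C₁ ε₀ ξ : ℝ) (R : ℕ) : ℝ :=
  C₁ * ε₀ ^ 2 + 2 * ε₀ * ξ * ((R : ℝ) - 1) + ξ ^ 2 * ((R : ℝ) - 1)



lemma aux_cs {d : ℕ} (a b : Fin d → ℝ) : |∑ i, a i * b i| ≤ l2 a * l2 b := by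
  unfold l2
  rw [← Real.sqrt_mul (Finset.sum_nonneg fun i _ => sq_nonneg _)]
  apply Real.abs_le_sqrt
  exact Finset.sum_mul_sq_le_sq_mul_sq _ _ _

lemma aux_sq {d : ℕ} (a : Fin d → ℝ) : l2 a ^ 2 = ∑ i, a i ^ 2 :=
  Real.sq_sqrt (Finset.sum_nonneg fun i _ => sq_nonneg _)

lemma aux_nonneg {d : ℕ} (a : Fin d → ℝ) : 0 ≤ l2 a := Real.sqrt_nonneg _

lemma aux_coord {d : ℕ} (a : Fin d → ℝ) (ha : l2 a = 1) (i : Fin d) : |a i| ≤ 1 := by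
  have h := aux_sq a
  rw [ha] at h
  have h2 : a i ^ 2 ≤ ∑ i, a i ^ 2 :=
    Finset.single_le_sum (f := fun i => a i ^ 2) (fun i _ => sq_nonneg _) (Finset.mem_univ i)
  rw [abs_le_one_iff_mul_self_le_one]
  nlinarith

lemma aux_eta {d₁ d₂ d₃ : ℕ} (E : Fin d₁ × Fin d₂ × Fin d₃ → ℝ) (s₁ s₂ s₃ : ℕ)
    (u : Fin d₁ → ℝ) (v : Fin d₂ → ℝ) (w : Fin d₃ → ℝ)
    (hu : l2 u = 1) (hv : l2 v = 1) (hw : l2 w = 1)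
    (h1 : (Function.support u).ncard ≤ s₁) (h2 : (Function.support v).ncard ≤ s₂)
    (h3 : (Function.support w).ncard ≤ s₃) :
    |∑ i, ∑ j, ∑ k, E (i, j, k) * u i * v j * w k| ≤ eta E s₁ s₂ s₃ := by
  apply le_csSup
  · refine ⟨∑ i, ∑ j, ∑ k, |E (i, j, k)|, ?_⟩
    rintro x ⟨u, v, w, hu, hv, hw, -, -, -, rfl⟩
    refine (Finset.abs_sum_le_sum_abs _ _).trans (Finset.sum_le_sum fun i _ => ?_)
    refine (Finset.abs_sum_le_sum_abs _ _).trans (Finset.sum_le_sum fun j _ => ?_)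
    refine (Finset.abs_sum_le_sum_abs _ _).trans (Finset.sum_le_sum fun k _ => ?_)
    rw [abs_mul, abs_mul, abs_mul]
    have a1 := aux_coord u hu i
    have a2 := aux_coord v hv j
    have a3 := aux_coord w hw k
    have e := abs_nonneg (E (i, j, k))
    have b1 := mul_le_of_le_one_right e a1
    have b2 := mul_le_of_le_one_right (mul_nonneg e (abs_nonneg (u i))) a2
    have b3 := mul_le_of_le_one_right
      (mul_nonneg (mul_nonneg e (abs_nonneg (u i))) (abs_nonneg (v j))) a3
    linarith
  · exact ⟨u, v, w, hu, hv, hw, h1, h2, h3, rfl⟩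

lemma aux_supp {d : ℕ} (a : Fin d → ℝ) (F : Finset (Fin d)) (s : ℕ)
    (h : Function.support a ⊆ ↑F) (hc : F.card ≤ s) : (Function.support a).ncard ≤ s := by
  have := Set.ncard_le_ncard h F.finite_toSet
  rw [Set.ncard_coe_finset] at this
  omega

lemma aux_self {d : ℕ} (b u : Fin d → ℝ) (ε : ℝ) (hb : l2 b = 1) (hu : l2 u = 1)
    (h : l2 (fun i => u i - b i) ≤ ε) : 1 - ε ^ 2 / 2 ≤ ∑ i, b i * u i := by
  have h1 := aux_sq b
  have h2 := aux_sq u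
  have h3 := aux_sq (fun i => u i - b i)
  have h4 : ∑ i, (u i - b i) ^ 2 = ∑ i, u i ^ 2 - 2 * ∑ i, b i * u i + ∑ i, b i ^ 2 := by
    rw [Finset.mul_sum, ← Finset.sum_sub_distrib, ← Finset.sum_add_distrib]
    exact Finset.sum_congr rfl fun i _ => by ring
  have h5 := pow_le_pow_left₀ (aux_nonneg _) h 2
  rw [hb] at h1
  rw [hu] at h2
  linarith

lemma aux_other {d : ℕ} (c b u : Fin d → ℝ) (ε ξ : ℝ) (hc : l2 c = 1)
    (h : l2 (fun i => u i - b i) ≤ ε) (hξ : |∑ i, c i * b i| ≤ ξ) :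
    |∑ i, c i * u i| ≤ ξ + ε := by
  have h4 : ∑ i, c i * u i = ∑ i, c i * b i + ∑ i, c i * (u i - b i) := by
    rw [← Finset.sum_add_distrib]
    exact Finset.sum_congr rfl fun i _ => by ring
  have h5 := aux_cs c (fun i => u i - b i)
  rw [hc, one_mul] at h5
  rw [h4]
  exact (abs_add_le _ _).trans (add_le_add hξ (h5.trans h))

lemma aux_expand {d₁ d₂ d₃ R : ℕ} (w : Fin R → ℝ)
    (β₁ : Fin R → Fin d₁ → ℝ) (β₂ : Fin R → Fin d₂ → ℝ) (β₃ : Fin R → Fin d₃ → ℝ)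
    (E : Fin d₁ × Fin d₂ × Fin d₃ → ℝ)
    (u : Fin d₁ → ℝ) (v : Fin d₂ → ℝ) (z : Fin d₃ → ℝ)
    (F₁ : Finset (Fin d₁)) (F₂ : Finset (Fin d₂)) (F₃ : Finset (Fin d₃))
    (h1 : Function.support u ⊆ ↑F₁) (h2 : Function.support v ⊆ ↑F₂)
    (h3 : Function.support z ⊆ ↑F₃) :
    ∑ k, contract3 (restrict3
      (fun p => (∑ j, w j * outer3 (β₁ j) (β₂ j) (β₃ j) p) + E p) F₁ F₂ F₃) u v k * z k
    = ∑ l, w l * ((∑ i, β₁ l i * u i) * (∑ j, β₂ l j * v j) * (∑ k, β₃ l k * z k))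
      + ∑ i, ∑ j, ∑ k, E (i, j, k) * u i * v j * z k := by
  have key : ∀ i j k, restrict3
      (fun p => (∑ j, w j * outer3 (β₁ j) (β₂ j) (β₃ j) p) + E p) F₁ F₂ F₃ (i, j, k)
        * u i * v j * z k
      = (∑ l, w l * (β₁ l i * u i * (β₂ l j * v j) * (β₃ l k * z k)))
        + E (i, j, k) * u i * v j * z k := by
    intro i j k
    have e : (∑ l, w l * (β₁ l i * u i * (β₂ l j * v j) * (β₃ l k * z k)))
        = (∑ l, w l * outer3 (β₁ l) (β₂ l) (β₃ l) (i, j, k)) * u i * v j * z k := by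
      simp only [Finset.sum_mul, outer3]
      exact Finset.sum_congr rfl fun l _ => by ring
    rw [e]
    unfold restrict3
    split_ifs with h
    · ring
    · have hz : u i = 0 ∨ v j = 0 ∨ z k = 0 := by
        by_contra! hh
        exact h ⟨h1 hh.1, h2 hh.2.1, h3 hh.2.2⟩
      rcases hz with hz | hz | hz <;> simp [hz]
  have s1 : ∑ k, contract3 (restrict3
      (fun p => (∑ j, w j * outer3 (β₁ j) (β₂ j) (β₃ j) p) + E p) F₁ F₂ F₃) u v k * z k
      = ∑ i, ∑ j, ∑ k, restrict3
      (fun p => (∑ j, w j * outer3 (β₁ j) (β₂ j) (β₃ j) p) + E p) F₁ F₂ F₃ (i, j, k)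
        * u i * v j * z k := by
    simp only [contract3, Finset.sum_mul]
    rw [Finset.sum_comm]
    exact Finset.sum_congr rfl fun i _ => Finset.sum_comm
  rw [s1]
  simp only [key, Finset.sum_add_distrib]
  congr 1
  have s2 : ∀ l, w l * ((∑ i, β₁ l i * u i) * (∑ j, β₂ l j * v j) * (∑ k, β₃ l k * z k))
      = ∑ i, ∑ j, ∑ k, w l * (β₁ l i * u i * (β₂ l j * v j) * (β₃ l k * z k)) := by
    intro l
    rw [Finset.sum_mul_sum, Finset.sum_mul, Finset.mul_sum]
    refine Finset.sum_congr rfl fun i _ => ?_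
    rw [Finset.sum_mul, Finset.mul_sum]
    refine Finset.sum_congr rfl fun j _ => ?_
    rw [Finset.mul_sum, Finset.mul_sum]
  simp only [s2]
  symm
  rw [Finset.sum_comm]
  refine Finset.sum_congr rfl fun i _ => ?_
  rw [Finset.sum_comm]
  refine Finset.sum_congr rfl fun j _ => ?_
  rw [Finset.sum_comm]

/-- Denominator lower bound (S.bound_alpha) in Step 2 of the proof of Theorem 3. -/
theorem statement15 {d₁ d₂ d₃ R : ℕ} (hR : 1 ≤ R)
    (w : Fin R → ℝ) (hw : ∀ j, 0 < w j)
    (β₁ : Fin R → Fin d₁ → ℝ) (β₂ : Fin R → Fin d₂ → ℝ) (β₃ : Fin R → Fin d₃ → ℝ)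
    (hβ₁ : ∀ j, l2 (β₁ j) = 1) (hβ₂ : ∀ j, l2 (β₂ j) = 1) (hβ₃ : ∀ j, l2 (β₃ j) = 1)
    (E T : Fin d₁ × Fin d₂ × Fin d₃ → ℝ)
    (hT : T = fun p => (∑ j, w j * outer3 (β₁ j) (β₂ j) (β₃ j) p) + E p)
    (wmax : ℝ) (hwmax : IsGreatest (Set.range w) wmax)
    (ξ : ℝ) (hξ0 : 0 ≤ ξ)
    (hξ₁ : ∀ i j : Fin R, i ≠ j → |∑ t, β₁ i t * β₁ j t| ≤ ξ)
    (hξ₂ : ∀ i j : Fin R, i ≠ j → |∑ t, β₂ i t * β₂ j t| ≤ ξ)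
    (hξ₃ : ∀ i j : Fin R, i ≠ j → |∑ t, β₃ i t * β₃ j t| ≤ ξ)
    (r : Fin R)
    (C₁ : ℝ) (hC₁ : (∑ j ∈ Finset.univ.erase r, w j) ≤ C₁ * wmax)
    (u : Fin d₁ → ℝ) (v : Fin d₂ → ℝ) (hu : l2 u = 1) (hv : l2 v = 1)
    (ε₀ : ℝ) (hε₀0 : 0 < ε₀) (hε₀1 : ε₀ < 1)
    (hu' : l2 (fun i => u i - β₁ r i) ≤ ε₀) (hv' : l2 (fun i => v i - β₂ r i) ≤ ε₀)
    (s₁ s₂ s₃ : ℕ)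
    (F₁ : Finset (Fin d₁)) (F₂ : Finset (Fin d₂)) (F₃ : Finset (Fin d₃))
    (hF₁ : Function.support u ∪ Function.support (β₁ r) ⊆ ↑F₁) (hF₁c : F₁.card ≤ s₁)
    (hF₂ : Function.support v ∪ Function.support (β₂ r) ⊆ ↑F₂) (hF₂c : F₂.card ≤ s₂)
    (hF₃ : Function.support (β₃ r) ⊆ ↑F₃) (hF₃c : F₃.card ≤ s₃) :
    w r * (1 - ε₀ ^ 2)
        - wmax * (2 * ε₀ * ξ * ((R : ℝ) - 1) + C₁ * ε₀ ^ 2 + ξ ^ 2 * ((R : ℝ) - 1))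
        - eta E s₁ s₂ s₃
      ≤ l2 (contract3 (restrict3 T F₁ F₂ F₃) u v) := by
  subst hT
  have hu1 : Function.support u ⊆ ↑F₁ := Set.subset_union_left.trans hF₁
  have hv1 : Function.support v ⊆ ↑F₂ := Set.subset_union_left.trans hF₂
  have hexp := aux_expand w β₁ β₂ β₃ E u v (β₃ r) F₁ F₂ F₃ hu1 hv1 hF₃
  have hE := aux_eta E s₁ s₂ s₃ u v (β₃ r) hu hv (hβ₃ r) (aux_supp u F₁ s₁ hu1 hF₁c)
    (aux_supp v F₂ s₂ hv1 hF₂c) (aux_supp (β₃ r) F₃ s₃ hF₃ hF₃c)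
  have hcs := aux_cs (contract3 (restrict3
      (fun p => (∑ j, w j * outer3 (β₁ j) (β₂ j) (β₃ j) p) + E p) F₁ F₂ F₃) u v) (β₃ r)
  rw [hβ₃ r, mul_one] at hcs
  have hcs' := (le_abs_self _).trans hcs
  rw [hexp, ← Finset.add_sum_erase _ _ (Finset.mem_univ r)] at hcs'
  have hE' := neg_le_of_abs_le hE
  have hwm : ∀ j, w j ≤ wmax := fun j => hwmax.2 ⟨j, rfl⟩
  have hself : w r * (1 - ε₀ ^ 2) ≤ w r * ((∑ i, β₁ r i * u i) * (∑ j, β₂ r j * v j)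
      * (∑ k, β₃ r k * β₃ r k)) := by
    apply mul_le_mul_of_nonneg_left _ (hw r).le
    have h3 : ∑ k, β₃ r k * β₃ r k = 1 := by
      have := aux_sq (β₃ r)
      rw [hβ₃ r] at this
      simp only [← pow_two]
      linarith
    rw [h3, mul_one]
    have a := aux_self (β₁ r) u ε₀ (hβ₁ r) hu hu'
    have b := aux_self (β₂ r) v ε₀ (hβ₂ r) hv hv'
    have c : 0 ≤ 1 - ε₀ ^ 2 / 2 := by nlinarith
    have := mul_le_mul a b c (c.trans a)
    nlinarith [sq_nonneg (ε₀ ^ 2)]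
  have hoth : ∀ j ∈ Finset.univ.erase r,
      -(wmax * (2 * ε₀ * ξ + ξ ^ 2) + w j * ε₀ ^ 2) ≤
      w j * ((∑ i, β₁ j i * u i) * (∑ i, β₂ j i * v i) * (∑ k, β₃ j k * β₃ r k)) := by
    intro j hj
    have hjr : j ≠ r := Finset.ne_of_mem_erase hj
    have a := aux_other (β₁ j) (β₁ r) u ε₀ ξ (hβ₁ j) hu' (hξ₁ j r hjr)
    have b := aux_other (β₂ j) (β₂ r) v ε₀ ξ (hβ₂ j) hv' (hξ₂ j r hjr)
    have c := aux_cs (β₃ j) (β₃ r)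
    rw [hβ₃, hβ₃, mul_one] at c
    have ab := mul_le_mul a b (abs_nonneg _) (by linarith)
    have abc := mul_le_mul ab c (abs_nonneg _) (by positivity)
    rw [← abs_mul, ← abs_mul] at abc
    have l := neg_le_of_abs_le abc
    have l2 := mul_le_mul_of_nonneg_left l (hw j).le
    have m := mul_le_mul_of_nonneg_right (hwm j)
      (show 0 ≤ 2 * ε₀ * ξ + ξ ^ 2 by positivity)
    nlinarith
  have hsum := Finset.sum_le_sum hoth
  rw [Finset.sum_neg_distrib, Finset.sum_add_distrib, Finset.sum_const, ← Finset.sum_mul,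
    Finset.card_erase_of_mem (Finset.mem_univ r), Finset.card_univ, Fintype.card_fin,
    nsmul_eq_mul, Nat.cast_sub hR, Nat.cast_one] at hsum
  have hC := mul_le_mul_of_nonneg_right hC₁ (sq_nonneg ε₀)
  nlinarith
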